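/- Let $\mathcal{A}$ be an abelian category, $M, N$ objects, and suppose $\mathcal{M}^\bullet = (0 \to M_n \to \dots \to M_0 \to 0)$ is a complex whose only nonzero cohomology is $M$ in degree $0$, such that $\mathrm{Ext}^i(M_j, M_k^\vee) = 0$ for all $i > 0$ and all $j,k$ (where $M_k^\vee$ are the terms of the dual complex computing $N$), and there is a chain map $\mathcal{M}^\bullet \to (\mathcal{M}^\vee)^\bullet[2n]$ not homotopic to zero. Then $\mathrm{Ext}^{2n}(M, N) \neq 0$. -/

import Mathlib

open CategoryTheory CategoryTheory.Limits CategoryTheory.Abelian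

universe w v u

open HomologicalComplex CochainComplex HomComplex DerivedCategory

section

variable {C : Type u} [Category.{v} C] [Abelian C]

namespace CochainComplex

/-- When `K` is exact in degree `n`, the opcycles of `K` in degree `n` embed into `K.X (n + 1)`
with cokernel the opcycles in degree `n + 1`. -/
lemma shortExact_opcycles (K : CochainComplex C ℤ) (n m : ℤ) (hnm : n + 1 = m)
    (hK : K.ExactAt n) :
    (ShortComplex.mk (K.fromOpcycles n m) (K.pOpcycles m)
      (by simp [← cancel_epi (K.pOpcycles n)])).ShortExact := by
  obtain rfl : (ComplexShape.up ℤ).next n = m := by simp [hnm]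
  have hm : Mono (K.fromOpcycles n ((ComplexShape.up ℤ).next n)) :=
    ShortComplex.Exact.mono_fromOpcycles hK
  refine { exact := ?_, mono_f := hm, epi_g := inferInstanceAs (Epi (K.pOpcycles _)) }
  refine ShortComplex.exact_of_g_is_cokernel _ (CokernelCofork.IsColimit.ofπ' _ _ ?_)
  intro A k hk
  refine ⟨K.descOpcycles k n (by simp [← hnm]) ?_, K.p_descOpcycles _ _ _ _⟩
  rw [← K.p_fromOpcycles, Category.assoc]
  exact (congrArg _ hk).trans comp_zero

section

variable [HasExt.{w} C]

lemma subsingleton_ext_opcycles (K : CochainComplex C ℤ) (hK : K.Acyclic) (d : ℤ)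
    [K.IsStrictlyLE d] (B : C)
    (hB : ∀ (a : ℤ) (i : ℕ), 0 < i → Subsingleton (Ext.{w} (K.X a) B i))
    (n : ℤ) (i : ℕ) (hi : 0 < i) : Subsingleton (Ext.{w} (K.opcycles n) B i) := by
  obtain ⟨k, hk⟩ : ∃ k : ℕ, d < n + k := ⟨(d - n + 1).toNat, by lia⟩
  induction k generalizing n i with
  | zero =>
    have hz : IsZero (K.opcycles n) :=
      (K.isZero_of_isStrictlyLE d n (by lia)).of_epi (K.pOpcycles n)
    refine subsingleton_of_forall_eq 0 fun x ↦ ?_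
    rw [← Ext.mk₀_id_comp x, hz.eq_of_src (𝟙 _) 0, Ext.mk₀_zero, Ext.zero_comp]
  | succ k ih =>
    have hS := K.shortExact_opcycles n (n + 1) rfl (hK n)
    have h₁ := ih (n + 1) (1 + i) (by lia) (by lia)
    have h₂ := hB (n + 1) i hi
    refine subsingleton_of_forall_eq 0 fun x ↦ ?_
    obtain ⟨y, rfl⟩ := Ext.contravariant_sequence_exact₁ hS B x rfl (h₁.elim _ _)
    rw [h₂.elim y 0, Ext.comp_zero]

lemma exists_d_comp_eq_of_subsingleton_ext (K : CochainComplex C ℤ) (hK : K.Acyclic) (d : ℤ)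
    [K.IsStrictlyLE d] (B : C)
    (hB : ∀ (a : ℤ) (i : ℕ), 0 < i → Subsingleton (Ext.{w} (K.X a) B i))
    (l n m : ℤ) (hln : l + 1 = n) (hnm : n + 1 = m) (u : K.X n ⟶ B) (hu : K.d l n ≫ u = 0) :
    ∃ β : K.X m ⟶ B, K.d n m ≫ β = u := by
  have hS := K.shortExact_opcycles n m hnm (hK n)
  have h₁ := subsingleton_ext_opcycles K hK d B hB m 1 (by lia)
  obtain ⟨y, hy⟩ := Ext.contravariant_sequence_exact₁ hS B
    (Ext.mk₀ (K.descOpcycles u l (by simp [← hln]) hu)) (n₁ := 1) rfl (h₁.elim _ _)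
  obtain ⟨β, rfl⟩ := (Ext.mk₀_bijective _ _).2 y
  refine ⟨β, ?_⟩
  rw [Ext.mk₀_comp_mk₀] at hy
  have := (Ext.mk₀_bijective _ _).1 hy
  dsimp at this
  rw [← K.p_fromOpcycles, Category.assoc, this, K.p_descOpcycles]

end

lemma exists_single_eqUpTo {K L : CochainComplex C ℤ}
    (f : K ⟶ L) (α : Cochain K L (-1)) (n m : ℤ) (hnm : n + 1 = m)
    (hm : ∀ u : K.X m ⟶ L.X m, K.d n m ≫ u = 0 →
      ∃ β : K.X (m + 1) ⟶ L.X m, K.d m (m + 1) ≫ β = u)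
    (hα : (δ (-1) 0 α).EqUpTo (Cochain.ofHom f) n) :
    ∃ (h : K.X (n + 2) ⟶ L.X (n + 1)),
      (δ (-1) 0 (α + Cochain.single h (-1))).EqUpTo (Cochain.ofHom f) m := by
  subst hnm
  let u := f.f (n + 1) - α.v (n + 1) n (by lia) ≫ L.d n (n + 1) -
    K.d (n + 1) (n + 2) ≫ α.v (n + 2) (n + 1) (by lia)
  have hu : K.d n (n + 1) ≫ u = 0 := by
    have eq := hα n n (add_zero n) (by rfl)
    simp only [δ_v (-1) 0 (neg_add_cancel 1) α n n (add_zero _) (n - 1) (n + 1)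
      (by lia) (by lia), Int.negOnePow_zero, one_smul, Cochain.ofHom_v] at eq
    simp only [u, Preadditive.comp_sub, HomologicalComplex.d_comp_d_assoc, zero_comp,
      ← f.comm, ← eq, Preadditive.add_comp, Category.assoc, L.d_comp_d, comp_zero, zero_add,
      sub_self]
  obtain ⟨β, hβ⟩ : ∃ (β : K.X (n + 2) ⟶ L.X (n + 1)), K.d (n + 1) (n + 2) ≫ β = u := by
    have := hm u hu
    rwa [show n + 1 + 1 = n + 2 by lia] at this
  refine ⟨β, ?_⟩
  intro p q hpq hp
  obtain rfl : p = q := by lia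
  obtain hp | rfl := hp.lt_or_eq
  · rw [δ_add, Cochain.add_v, hα p p (by lia) (by lia), add_eq_left,
      δ_v (-1) 0 (neg_add_cancel 1) _ p p hpq (p - 1) (p + 1) rfl rfl,
      Cochain.single_v_eq_zero _ _ _ _ _ (by lia),
      Cochain.single_v_eq_zero _ _ _ _ _ (by lia)]
    simp
  · rw [δ_v (-1) 0 (neg_add_cancel 1) _ (n + 1) (n + 1) (by lia) n (n + 2)
      (by lia) (by lia), Cochain.add_v,
      Cochain.single_v_eq_zero _ _ _ _ _ (by lia)]
    simp [hβ, u]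

open Cochain.InductionUp in
/-- A morphism `f : K ⟶ L` to a bounded below complex is null-homotopic as soon as any
`u : K.X m ⟶ L.X m` which vanishes on boundaries factors through the differential of `K`. -/
lemma nonempty_homotopy_zero_of_exists_d_comp_eq {K L : CochainComplex C ℤ} (f : K ⟶ L) (d : ℤ)
    [L.IsStrictlyGE d]
    (h : ∀ (n m : ℤ), n + 1 = m → ∀ u : K.X m ⟶ L.X m, K.d n m ≫ u = 0 →
      ∃ β : K.X (m + 1) ⟶ L.X m, K.d m (m + 1) ≫ β = u) :
    Nonempty (Homotopy f 0) := by
  let X (n : ℕ) : Set (Cochain K L (-1)) :=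
    Set.ofPred (fun α => (δ (-1) 0 α).EqUpTo (Cochain.ofHom f) (n + d - 1))
  let x₀ : X 0 := ⟨0, fun p q hpq hp ↦
    IsZero.eq_of_tgt (L.isZero_of_isStrictlyGE d _ (by lia)) _ _⟩
  let φ (n : ℕ) (α : X n) : X (n + 1) :=
    ⟨_, (exists_single_eqUpTo f α.1 (n + d - 1) ((n + 1 : ℕ) + d - 1)
      (by lia) (h _ _ (by lia)) α.2).choose_spec⟩
  have hφ (k : ℕ) (x : X k) : (φ k x).1.EqUpTo x.1 (d + k) := fun p q hpq hp => by
    dsimp [φ]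
    rw [add_eq_left, Cochain.single_v_eq_zero _ _ _ _ _ (by lia)]
  refine ⟨(Cochain.equivHomotopy f 0).symm ⟨limitSequence φ hφ x₀, ?_⟩⟩
  rw [Cochain.ofHom_zero, add_zero]
  ext n
  let k₀ := (n - d + 1).toNat
  rw [← (sequence φ x₀ k₀).2 n n (add_zero n) (by lia),
    δ_v (-1) 0 (neg_add_cancel 1) _ n n (by lia) (n - 1) (n + 1) rfl (by lia),
    δ_v (-1) 0 (neg_add_cancel 1) _ n n (by lia) (n - 1) (n + 1) rfl (by lia),
    limitSequence_eqUpTo φ hφ x₀ k₀ n (n - 1) (by lia) (by lia),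
    limitSequence_eqUpTo φ hφ x₀ k₀ (n + 1) n (by lia) (by lia)]

lemma acyclic_mappingCone {K L : CochainComplex C ℤ} (f : K ⟶ L) [QuasiIso f] :
    (mappingCone f).Acyclic := by
  rw [← HomotopyCategory.quotient_obj_mem_subcategoryAcyclic_iff_acyclic]
  refine ((HomotopyCategory.subcategoryAcyclic C).trW_iff_of_distinguished _
    (HomotopyCategory.mappingCone_triangleh_distinguished f)).1 ?_
  rw [← HomotopyCategory.quasiIso_eq_trW_subcategoryAcyclic]
  exact (HomotopyCategory.quotient_map_mem_quasiIso_iff f).2 ‹_›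

lemma subsingleton_ext_mappingCone [HasExt.{w} C] {K L : CochainComplex C ℤ} (f : K ⟶ L)
    (p : ℤ) (B : C) (i : ℕ) (hK : Subsingleton (Ext.{w} (K.X (p + 1)) B i))
    (hL : Subsingleton (Ext.{w} (L.X p) B i)) :
    Subsingleton (Ext.{w} ((mappingCone f).X p) B i) := by
  refine subsingleton_of_forall_eq 0 fun x ↦ ?_
  rw [← Ext.mk₀_id_comp x, ← mappingCone.id_X f p (p + 1) rfl, Ext.mk₀_add, Ext.add_comp,
    ← Ext.mk₀_comp_mk₀_assoc, ← Ext.mk₀_comp_mk₀_assoc,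
    hK.elim ((Ext.mk₀ _).comp x _) 0, hL.elim ((Ext.mk₀ _).comp x _) 0,
    Ext.comp_zero, Ext.comp_zero, add_zero]

/-- If `s : P ⟶ X` is a quasi-isomorphism from a bounded above complex of projective objects to
a bounded above complex, and there are no higher `Ext`-groups from the terms of `X` to those
of the bounded below complex `Y`, then a morphism `f : X ⟶ Y` is null-homotopic
when `s ≫ f` is. -/
lemma nonempty_homotopy_zero_of_quasiIso [HasExt.{w} C] {P X Y : CochainComplex C ℤ}
    (s : P ⟶ X) [QuasiIso s] (f : X ⟶ Y) (a b : ℤ) [P.IsStrictlyLE b] [X.IsStrictlyLE b]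
    [Y.IsStrictlyGE a] [∀ n, Projective (P.X n)]
    (hext : ∀ (a b : ℤ) (i : ℕ), 0 < i → Subsingleton (Ext.{w} (X.X a) (Y.X b) i))
    (h : Homotopy (s ≫ f) 0) : Nonempty (Homotopy f 0) := by
  obtain ⟨α, hα⟩ := Cochain.equivHomotopy _ _ h
  rw [Cochain.ofHom_zero, add_zero] at hα
  have : (mappingCone s).IsStrictlyLE b := by
    rw [isStrictlyLE_iff]
    intro i hi
    rw [mappingCone.isZero_X_iff]
    exact ⟨P.isZero_of_isStrictlyLE b _ (by lia), X.isZero_of_isStrictlyLE b _ hi⟩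
  obtain ⟨H⟩ := nonempty_homotopy_zero_of_exists_d_comp_eq (mappingCone.desc s α f hα.symm) a
    (fun n m hnm u hu ↦ exists_d_comp_eq_of_subsingleton_ext.{w} (mappingCone s)
      (acyclic_mappingCone s) b (Y.X m) (fun p i hi ↦ by
        refine subsingleton_ext_mappingCone s p _ i ?_ (hext _ _ _ hi)
        obtain ⟨i, rfl⟩ := Nat.exists_eq_succ_of_ne_zero hi.ne'
        exact Ext.subsingleton_of_projective _ _ _) n m (m + 1) hnm rfl u hu)
  exact ⟨(Homotopy.ofEq (by simp)).trans ((H.compLeft (mappingCone.inr s)).trans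
    (Homotopy.ofEq (by simp)))⟩

end CochainComplex

namespace DerivedCategory

variable [HasDerivedCategory C]

lemma nonempty_iso_singleFunctor_obj (K : CochainComplex C ℤ) (n : ℤ)
    (hK : ∀ j, j ≠ n → IsZero (K.homology j)) {A : C} (e : K.homology n ≅ A) :
    Nonempty (Q.obj K ≅ (singleFunctor C n).obj A) := by
  have : K.IsGE n := by
    rw [CochainComplex.isGE_iff]
    exact fun i hi ↦ (K.exactAt_iff_isZero_homology i).2 (hK i hi.ne)
  have : K.IsLE n := by
    rw [CochainComplex.isLE_iff]
    exact fun i hi ↦ (K.exactAt_iff_isZero_homology i).2 (hK i hi.ne')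
  obtain ⟨B, ⟨e'⟩⟩ := exists_iso_singleFunctor_obj_of_isGE_of_isLE (Q.obj K) n
  exact ⟨e' ≪≫ (singleFunctor C n).mapIso
    (((singleFunctorCompHomologyFunctorIso C n).app B).symm ≪≫
      (homologyFunctor C n).mapIso e'.symm ≪≫ (homologyFunctorFactors C n).app K ≪≫ e)⟩

lemma exists_Q_map_eq {P X : CochainComplex C ℤ} [P.IsKProjective]
    (φ : Q.obj P ⟶ Q.obj X) : ∃ s : P ⟶ X, Q.map s = φ := by
  obtain ⟨g, hg⟩ := (IsKProjective.Qh_map_bijective P _).2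
    ((quotientCompQhIso C).hom.app P ≫ φ ≫ (quotientCompQhIso C).inv.app X)
  obtain ⟨s, rfl⟩ := (HomotopyCategory.quotient _ _).map_surjective g
  refine ⟨s, ?_⟩
  rw [← cancel_epi ((quotientCompQhIso C).hom.app P), ← quotientCompQhIso_hom_naturality, hg]
  simp

lemma nonempty_homotopy_zero_of_Q_map_eq_zero {P X : CochainComplex C ℤ} [P.IsKProjective]
    (f : P ⟶ X) (hf : Q.map f = 0) : Nonempty (Homotopy f 0) := by
  refine ⟨HomotopyCategory.homotopyOfEq _ _ ((IsKProjective.Qh_map_bijective P _).1 ?_)⟩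
  rw [← cancel_mono ((quotientCompQhIso C).hom.app X), quotientCompQhIso_hom_naturality, hf]
  simp

end DerivedCategory

end

/-- Let `X`, `Y` be bounded complexes in an abelian category with enough projectives, with the
only nonzero cohomology of `X` being `M` in degree `0` and the only nonzero cohomology of `Y`
being `N` in degree `-2n`, and suppose `Ext^i(X^a, Y^b) = 0` for all `i > 0` and all `a, b`.
Then any chain map `X ⟶ Y` which is not null-homotopic gives a nonzero element of
`Hom_{D^b}(M, N[2n])`, i.e. `Ext^{2n}(M, N) ≠ 0`. -/
theorem ext_nonzero_of_not_nullhomotopic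
    {C : Type u} [Category.{v} C] [Abelian C] [EnoughProjectives C] [HasExt.{w} C]
    (n : ℕ) (X Y : CochainComplex C ℤ)
    (hXbdd : ∃ a b : ℤ, ∀ j : ℤ, (j < a ∨ b < j) → IsZero (X.X j))
    (hYbdd : ∃ a b : ℤ, ∀ j : ℤ, (j < a ∨ b < j) → IsZero (Y.X j))
    (hXhom : ∀ j : ℤ, j ≠ 0 → IsZero (X.homology j))
    (hYhom : ∀ j : ℤ, j ≠ -(2 * n : ℤ) → IsZero (Y.homology j))
    (M N : C) (eM : X.homology 0 ≅ M) (eN : Y.homology (-(2 * n : ℤ)) ≅ N)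
    (hext : ∀ (a b : ℤ) (i : ℕ), 0 < i → Subsingleton (Ext (X.X a) (Y.X b) i))
    (f : X ⟶ Y) (hf : ¬ Nonempty (Homotopy f 0)) :
    ∃ e : Ext M N (2 * n), e ≠ 0 := by
  let := HasDerivedCategory.standard C
  obtain ⟨_, b, hb⟩ := hXbdd
  obtain ⟨a, _, ha⟩ := hYbdd
  by_contra! hzero
  obtain ⟨eX⟩ := nonempty_iso_singleFunctor_obj X 0 hXhom eM
  obtain ⟨eY⟩ := nonempty_iso_singleFunctor_obj Y _ hYhom eN
  have hf₀ : Q.map f = 0 := by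
    let eY' := eY ≪≫ (((DerivedCategory.singleFunctors C).shiftIso ((2 * n : ℕ) : ℤ) (-(2 * n : ℤ)) 0
      (by simp)).app N).symm
    obtain ⟨x, hx⟩ := Ext.homEquiv.surjective (eX.inv ≫ Q.map f ≫ eY'.hom)
    rw [hzero x] at hx
    have hx₀ : eX.inv ≫ Q.map f ≫ eY'.hom = 0 := hx.symm.trans (Ext.zero_hom _ _ _)
    simpa using hx₀
  let R := ProjectiveResolution.of M
  obtain ⟨s, hs⟩ := exists_Q_map_eq
    (Q.map R.π' ≫ (singleFunctorIsoCompQ C 0).inv.app M ≫ eX.inv)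
  have : QuasiIso s := by
    rw [← isIso_Q_map_iff_quasiIso, hs]
    infer_instance
  have : X.IsStrictlyLE (max 0 b) := by
    rw [CochainComplex.isStrictlyLE_iff]
    exact fun i hi ↦ hb i (Or.inr (by lia))
  have : R.cochainComplex.IsStrictlyLE (max 0 b) :=
    R.cochainComplex.isStrictlyLE_of_le 0 _ (by lia)
  have : Y.IsStrictlyGE a := by
    rw [CochainComplex.isStrictlyGE_iff]
    exact fun i hi ↦ ha i (Or.inl hi)
  obtain ⟨h⟩ := nonempty_homotopy_zero_of_Q_map_eq_zero (s ≫ f) (by simp [hf₀])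
  exact hf (nonempty_homotopy_zero_of_quasiIso s f a (max 0 b) hext h)
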